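/- Let d ≥ 1, M ∈ ℕ, and let u : ℤ^d → ℝ be a harmonic polynomial of degree M, i.e. u is harmonic on all of ℤ^d and equals the evaluation of a real polynomial in d variables of total degree at most M. Let 0 ≤ ε < 0.5. Then for every natural number n with n^{1−2ε} > M² and n > 16, Q_u(2n) ≤ √( e^{n^{−2ε}} · Q_u(n) · Q_u(4n) ), where Q_u(m) = (A^m(u²))(0). -/

import Mathlib

/-- The standard generators of `ℤ^d`: `±e_i`, indexed by `Fin d × Bool`. -/
def latticeGen (d : ℕ) (s : Fin d × Bool) : Fin d → ℤ :=
  fun j => if s.1 = j then (if s.2 then 1 else -1) else 0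

/-- The averaging operator `(A f)(x) = (1/(2d)) ∑_{s ∈ S} f(x+s)`. -/
noncomputable def latticeAvg (d : ℕ) (f : (Fin d → ℤ) → ℝ) : (Fin d → ℤ) → ℝ :=
  fun x => (1 / (2 * (d : ℝ))) * ∑ s : Fin d × Bool, f (x + latticeGen d s)

/-- The discrete Laplacian `Δf = Af − f`. -/
noncomputable def latticeLap (d : ℕ) (f : (Fin d → ℤ) → ℝ) : (Fin d → ℤ) → ℝ :=
  fun x => latticeAvg d f x - f x

/-- The growth function `Q_u(n) = (Aⁿ (u²))(0)`. -/
noncomputable def growthQ (d : ℕ) (u : (Fin d → ℤ) → ℝ) (n : ℕ) : ℝ :=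
  (latticeAvg d)^[n] (fun y => (u y) ^ 2) 0

/-- Forward difference of a function on `ℕ`. -/
def fdiff (g : ℕ → ℝ) : ℕ → ℝ := fun n => g (n + 1) - g n

open Finset

/-- The averaging operator as a linear map. -/
noncomputable def latticeAvgLin (d : ℕ) : Module.End ℝ ((Fin d → ℤ) → ℝ) where
  toFun := latticeAvg d
  map_add' f g := by
    ext x
    simp only [latticeAvg, Pi.add_apply, sum_add_distrib, mul_add]
  map_smul' c f := by
    ext x
    simp only [latticeAvg, Pi.smul_apply, smul_eq_mul, ← mul_sum, RingHom.id_apply]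
    ring

/-- The discrete Laplacian as a linear map. -/
noncomputable def latticeLapLin (d : ℕ) : Module.End ℝ ((Fin d → ℤ) → ℝ) :=
  latticeAvgLin d - 1

theorem latticeLapLin_apply (d : ℕ) (f : (Fin d → ℤ) → ℝ) :
    latticeLapLin d f = latticeLap d f := rfl

/-- All `n`-fold differences of `f` along the standard generators vanish. -/
def DiffVanish (d : ℕ) : ℕ → ((Fin d → ℤ) → ℝ) → Prop
  | 0, f => f = 0
  | n + 1, f => ∀ s, DiffVanish d n (fwdDiff (latticeGen d s) f)

namespace DiffVanish

variable {d n m : ℕ} {f g : (Fin d → ℤ) → ℝ}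

theorem zero (n : ℕ) : DiffVanish d n 0 := by
  induction n with
  | zero => rfl
  | succ n ih =>
    intro s
    have : fwdDiff (latticeGen d s) (0 : (Fin d → ℤ) → ℝ) = 0 := by ext x; simp [fwdDiff]
    rwa [this]

theorem const (c : ℝ) : DiffVanish d 1 fun _ => c := by
  intro s
  ext x
  simp [fwdDiff]

theorem succ (hf : DiffVanish d n f) : DiffVanish d (n + 1) f := by
  induction n generalizing f with
  | zero =>
    obtain rfl : f = 0 := hf
    exact zero 1
  | succ n ih => exact fun s => ih (hf s)

theorem mono (hnm : n ≤ m) (hf : DiffVanish d n f) : DiffVanish d m f := by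
  induction m, hnm using Nat.le_induction with
  | base => exact hf
  | succ m _ ih => exact ih.succ

theorem add (hf : DiffVanish d n f) (hg : DiffVanish d n g) : DiffVanish d n (f + g) := by
  induction n generalizing f g with
  | zero =>
    obtain rfl : f = 0 := hf
    obtain rfl : g = 0 := hg
    exact add_zero 0
  | succ n ih =>
    intro s
    rw [fwdDiff_add]
    exact ih (hf s) (hg s)

theorem sum {ι : Type*} (t : Finset ι) {F : ι → (Fin d → ℤ) → ℝ}
    (hF : ∀ i ∈ t, DiffVanish d n (F i)) : DiffVanish d n (∑ i ∈ t, F i) :=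
  sum_induction F (DiffVanish d n) (fun _ _ => add) (zero n) hF

theorem const_smul (c : ℝ) (hf : DiffVanish d n f) : DiffVanish d n (c • f) := by
  induction n generalizing f with
  | zero =>
    obtain rfl : f = 0 := hf
    exact smul_zero c
  | succ n ih =>
    intro s
    rw [fwdDiff_const_smul]
    exact ih (hf s)

theorem shift (v : Fin d → ℤ) (hf : DiffVanish d n f) : DiffVanish d n fun x => f (x + v) := by
  induction n generalizing f with
  | zero =>
    obtain rfl : f = 0 := hf
    rfl
  | succ n ih =>
    intro s
    have h : fwdDiff (latticeGen d s) (fun x => f (x + v)) =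
        fun x => fwdDiff (latticeGen d s) f (x + v) := by
      ext x
      simp only [fwdDiff, add_right_comm]
    rw [h]
    exact ih (hf s)

theorem mul_coord (i : Fin d) (hf : DiffVanish d n f) :
    DiffVanish d (n + 1) fun x => f x * (x i : ℝ) := by
  induction n generalizing f with
  | zero =>
    obtain rfl : f = 0 := hf
    simpa using! zero 1
  | succ n ih =>
    intro s
    have h : fwdDiff (latticeGen d s) (fun x => f x * (x i : ℝ)) =
        (fun x => fwdDiff (latticeGen d s) f x * (x i : ℝ)) +
          (latticeGen d s i : ℝ) • fun x => f (x + latticeGen d s) := by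
      ext x
      simp only [fwdDiff, Pi.add_apply, Pi.smul_apply, smul_eq_mul]
      push_cast
      ring
    rw [h]
    exact (ih (hf s)).add ((hf.shift _).const_smul _)

end DiffVanish

theorem diffVanish_monomial {d : ℕ} (s : Fin d →₀ ℕ) (a : ℝ) :
    DiffVanish d ((MvPolynomial.monomial s a).totalDegree + 1)
      fun x => MvPolynomial.eval (fun i => (x i : ℝ)) (MvPolynomial.monomial s a) := by
  refine MvPolynomial.induction_on_monomial
    (motive := fun p => DiffVanish d (p.totalDegree + 1)
      fun x => MvPolynomial.eval (fun i => (x i : ℝ)) p) (fun a => ?_) (fun p i hp => ?_) s a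
  · simpa using DiffVanish.const a
  · by_cases h0 : p = 0
    · subst h0
      simpa using! DiffVanish.zero 1
    · rw [MvPolynomial.totalDegree_mul_of_isDomain h0 (MvPolynomial.X_ne_zero i),
        MvPolynomial.totalDegree_X]
      simpa using hp.mul_coord i

theorem diffVanish_eval {d : ℕ} (p : MvPolynomial (Fin d) ℝ) :
    DiffVanish d (p.totalDegree + 1) fun x => MvPolynomial.eval (fun i => (x i : ℝ)) p := by
  have h : (fun x : Fin d → ℤ => MvPolynomial.eval (fun i => (x i : ℝ)) p) =
      ∑ s ∈ p.support, fun x : Fin d → ℤ =>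
        MvPolynomial.eval (fun i => (x i : ℝ)) (MvPolynomial.monomial s (p.coeff s)) := by
    ext x
    conv_lhs => rw [p.as_sum]
    simp only [map_sum, Finset.sum_apply]
  rw [h]
  refine DiffVanish.sum _ fun s hs => (diffVanish_monomial s _).mono ?_
  gcongr
  exact (MvPolynomial.totalDegree_monomial_le _ _).trans (MvPolynomial.le_totalDegree hs)

theorem latticeLap_fwdDiff {d : ℕ} {u : (Fin d → ℤ) → ℝ} (hu : ∀ x, latticeLap d u x = 0)
    (v x : Fin d → ℤ) : latticeLap d (fwdDiff v u) x = 0 := by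
  have h : latticeLap d (fwdDiff v u) x = latticeLap d u (x + v) - latticeLap d u x := by
    simp only [latticeLap, latticeAvg, fwdDiff, sum_sub_distrib, add_right_comm x v]
    ring
  rw [h, hu, hu, sub_zero]

theorem latticeLapLin_sq {d : ℕ} (hd : 1 ≤ d) {u : (Fin d → ℤ) → ℝ}
    (hu : ∀ x, latticeLap d u x = 0) :
    latticeLapLin d (u ^ 2) =
      (1 / (2 * (d : ℝ))) • ∑ s, fwdDiff (latticeGen d s) u ^ 2 := by
  ext x
  have hd' : (d : ℝ) ≠ 0 := by positivity
  have hx := hu x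
  simp only [latticeLap, latticeAvg] at hx
  simp only [latticeLapLin_apply, latticeLap, latticeAvg, Pi.smul_apply, Finset.sum_apply, Pi.pow_apply,
    fwdDiff, smul_eq_mul, sub_sq, sum_add_distrib, sum_sub_distrib, ← sum_mul, ← mul_sum]
  simp only [sum_const, card_univ, Fintype.card_prod, Fintype.card_fin, Fintype.card_bool,
    nsmul_eq_mul]
  push_cast
  rw [sub_eq_zero, one_div, inv_mul_eq_iff_eq_mul₀ (by positivity)] at hx
  rw [hx]
  field_simp
  ring

theorem latticeLapLin_pow_sq_nonneg {d : ℕ} (hd : 1 ≤ d) (k : ℕ) {u : (Fin d → ℤ) → ℝ}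
    (hu : ∀ x, latticeLap d u x = 0) : 0 ≤ (latticeLapLin d ^ k) (u ^ 2) := by
  induction k generalizing u with
  | zero => exact fun x => sq_nonneg (u x)
  | succ k ih =>
    rw [pow_succ, Module.End.mul_apply, latticeLapLin_sq hd hu, map_smul, map_sum]
    exact smul_nonneg (by positivity) (sum_nonneg fun s _ => ih (latticeLap_fwdDiff hu _))

theorem latticeLapLin_pow_sq_eq_zero {d : ℕ} (hd : 1 ≤ d) {k : ℕ} {u : (Fin d → ℤ) → ℝ}
    (hu : ∀ x, latticeLap d u x = 0) (hk : DiffVanish d k u) :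
    (latticeLapLin d ^ k) (u ^ 2) = 0 := by
  induction k generalizing u with
  | zero =>
    obtain rfl : u = 0 := hk
    simp
  | succ k ih =>
    rw [pow_succ, Module.End.mul_apply, latticeLapLin_sq hd hu, map_smul, map_sum,
      sum_eq_zero fun s _ => ih (latticeLap_fwdDiff hu _) (hk s), smul_zero]

theorem growthQ_eq_sum {d : ℕ} (hd : 1 ≤ d) {M : ℕ} {u : (Fin d → ℤ) → ℝ}
    (hu : ∀ x, latticeLap d u x = 0) (hM : DiffVanish d (M + 1) u) (n : ℕ) :
    growthQ d u n =
      ∑ k ∈ range (M + 1), (latticeLapLin d ^ k) (u ^ 2) 0 * (n.choose k : ℝ) := by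
  have hpow : growthQ d u n = (latticeAvgLin d ^ n) (u ^ 2) 0 := by
    rw [Module.End.pow_apply]
    rfl
  have hsplit : latticeAvgLin d = latticeLapLin d + 1 := (sub_add_cancel _ _).symm
  have hsum : growthQ d u n =
      ∑ k ∈ range (n + 1), (latticeLapLin d ^ k) (u ^ 2) 0 * (n.choose k : ℝ) := by
    rw [hpow, hsplit, (Commute.one_right _).add_pow, LinearMap.sum_apply, Finset.sum_apply]
    refine sum_congr rfl fun k _ => ?_
    rw [one_pow, mul_one, ← nsmul_eq_mul', LinearMap.smul_apply, Pi.smul_apply, nsmul_eq_mul,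
      mul_comm]
  rw [hsum]
  have hN : range (n + 1) ⊆ range (n + M + 1) := range_subset_range.2 (by omega)
  have hM' : range (M + 1) ⊆ range (n + M + 1) := range_subset_range.2 (by omega)
  rw [sum_subset hN, sum_subset hM']
  · intro k _ hk
    rw [mem_range, not_lt] at hk
    obtain ⟨j, rfl⟩ := Nat.exists_eq_add_of_le' hk
    rw [pow_add, Module.End.mul_apply, latticeLapLin_pow_sq_eq_zero hd hu hM, map_zero,
      Pi.zero_apply, zero_mul]
  · intro k _ hk
    rw [mem_range, not_lt] at hk
    rw [Nat.choose_eq_zero_of_lt (by omega), Nat.cast_zero, mul_zero]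

theorem descFactorial_two_mul_sq_le {n : ℕ} (hn : 16 < n) (k : ℕ) (hk : k ^ 2 ≤ n) :
    ((2 * n).descFactorial k : ℝ) ^ 2 ≤
      Real.exp ((k : ℝ) ^ 2 / n) * n.descFactorial k * (4 * n).descFactorial k := by
  induction k with
  | zero => simp
  | succ k ih =>
    have hk4 : 4 * k ≤ n := by nlinarith
    have ih := ih (by nlinarith)
    have hn0 : (0 : ℝ) < n := by positivity
    have hk4' : 4 * (k : ℝ) ≤ n := by exact_mod_cast hk4
    have hk0 : (0 : ℝ) ≤ k := k.cast_nonneg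
    have hstep : (2 * n - k : ℝ) ^ 2 ≤
        Real.exp ((2 * k + 1) / n) * ((n - k) * (4 * n - k)) := by
      have h1 : 1 + 2 * (k : ℝ) / n ≤ Real.exp ((2 * k + 1) / n) := by
        refine le_trans ?_ (Real.add_one_le_exp _)
        rw [add_comm]
        gcongr
        linarith
      refine le_trans ?_ (mul_le_mul_of_nonneg_right h1 (by nlinarith))
      rw [one_add_div hn0.ne', div_mul_eq_mul_div, le_div_iff₀ hn0]
      have h2 : 0 ≤ (k : ℝ) * (7 * n ^ 2 - 10 * n * k + 2 * k ^ 2) :=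
        mul_nonneg hk0 (by nlinarith)
      linarith
    have hexp : Real.exp (((k + 1 : ℕ) : ℝ) ^ 2 / n) =
        Real.exp ((2 * k + 1) / n) * Real.exp ((k : ℝ) ^ 2 / n) := by
      rw [← Real.exp_add]
      push_cast
      ring_nf
    rw [hexp]
    simp only [Nat.descFactorial_succ, Nat.cast_mul]
    rw [Nat.cast_sub (by omega), Nat.cast_sub (by omega), Nat.cast_sub (by omega)]
    push_cast
    calc _ = (2 * n - k : ℝ) ^ 2 * ((2 * n).descFactorial k : ℝ) ^ 2 := by ring
      _ ≤ _ := mul_le_mul hstep ih (by positivity)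
        ((sq_nonneg _).trans hstep)
      _ = _ := by ring

theorem choose_two_mul_sq_le {n : ℕ} (hn : 16 < n) {k : ℕ} (hk : k ^ 2 ≤ n) :
    ((2 * n).choose k : ℝ) ^ 2 ≤
      Real.exp ((k : ℝ) ^ 2 / n) * n.choose k * (4 * n).choose k := by
  have h := descFactorial_two_mul_sq_le hn k hk
  simp only [Nat.descFactorial_eq_factorial_mul_choose, Nat.cast_mul] at h
  have hpos : (0 : ℝ) < (k.factorial : ℝ) ^ 2 := by positivity
  refine le_of_mul_le_mul_left ?_ hpos
  linarith

theorem stmt_11 (d : ℕ) (hd : 1 ≤ d) (M : ℕ) (u : (Fin d → ℤ) → ℝ)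
    (hu : ∀ x, latticeLap d u x = 0)
    (hpoly : ∃ p : MvPolynomial (Fin d) ℝ, p.totalDegree ≤ M ∧
      ∀ x : Fin d → ℤ, u x = MvPolynomial.eval (fun i => ((x i : ℝ))) p)
    (ε : ℝ) (hε0 : 0 ≤ ε) (hε1 : ε < 0.5) :
    ∀ n : ℕ, (n : ℝ) ^ (1 - 2 * ε) > (M : ℝ) ^ 2 → 16 < n →
      growthQ d u (2 * n) ≤
        Real.sqrt (Real.exp ((n : ℝ) ^ (-(2 * ε))) * growthQ d u n * growthQ d u (4 * n)) := by
  intro n hn hn16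
  obtain ⟨p, hp, hup⟩ := hpoly
  have hvan : DiffVanish d (M + 1) u := by
    rw [funext hup]
    exact (diffVanish_eval p).mono (by omega)
  have hn0 : (0 : ℝ) < n := by positivity
  have hsplit : (n : ℝ) ^ (1 - 2 * ε) = n * (n : ℝ) ^ (-(2 * ε)) := by
    rw [sub_eq_add_neg, Real.rpow_add hn0, Real.rpow_one]
  have hle1 : (n : ℝ) ^ (-(2 * ε)) ≤ 1 :=
    Real.rpow_le_one_of_one_le_of_nonpos (by exact_mod_cast hn0) (by linarith)
  rw [hsplit] at hn
  have hMn : M ^ 2 ≤ n := by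
    have : (M : ℝ) ^ 2 ≤ n := by nlinarith
    exact_mod_cast this
  have hdiv : (M : ℝ) ^ 2 / n ≤ (n : ℝ) ^ (-(2 * ε)) := by
    rw [div_le_iff₀ hn0]
    linarith
  apply Real.le_sqrt_of_sq_le
  simp only [growthQ_eq_sum hd hu hvan]
  rw [mul_sum _ _ (Real.exp _)]
  refine sum_sq_le_sum_mul_sum_of_sq_le_mul _ (fun k _ => ?_) (fun k _ => ?_) fun k hk => ?_
  · exact mul_nonneg (Real.exp_nonneg _)
      (mul_nonneg (latticeLapLin_pow_sq_nonneg hd k hu 0) (Nat.cast_nonneg _))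
  · exact mul_nonneg (latticeLapLin_pow_sq_nonneg hd k hu 0) (Nat.cast_nonneg _)
  · have hkM : k ≤ M := by
      rw [mem_range] at hk
      omega
    have hexp : Real.exp ((k : ℝ) ^ 2 / n) ≤ Real.exp ((n : ℝ) ^ (-(2 * ε))) := by
      refine Real.exp_le_exp.2 (le_trans ?_ hdiv)
      gcongr
    have hchoose : ((2 * n).choose k : ℝ) ^ 2 ≤
        Real.exp ((n : ℝ) ^ (-(2 * ε))) * n.choose k * (4 * n).choose k := by
      refine (choose_two_mul_sq_le hn16 ((Nat.pow_le_pow_left hkM 2).trans hMn)).trans ?_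
      gcongr
    calc _ = (latticeLapLin d ^ k) (u ^ 2) 0 ^ 2 * ((2 * n).choose k : ℝ) ^ 2 := mul_pow _ _ _
      _ ≤ _ := mul_le_mul_of_nonneg_left hchoose (sq_nonneg _)
      _ = _ := by ring
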